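/- Let T be a stable tree of the tree connection game and let P be a leaf-to-root path in T of length k. Then for every i with 1 < i < k, d_{i-1}^P ≥ (|T_i^P| / (|T_i^P| − |T_{i+1}^P|)) · (d_i^P − 1). In particular, the in-degree sequence d_k^P, …, d_0^P along any leaf-to-root path is monotonically non-decreasing towards the root, i.e., d_i^P ≥ d_{i+1}^P for 1 < i < k. -/

import Mathlib

open Function
open scoped ENNReal Classical

noncomputable section

namespace TCG

variable {n : ℕ}

/-- In-degree of node `v` in the network induced by profile `s` with root `r`:
the number of activated edges `(u, v)` with `u` an agent (a non-root node). -/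
def indeg (r : Fin (n + 1)) (s : Fin (n + 1) → Fin (n + 1)) (v : Fin (n + 1)) : ℕ :=
  Nat.card {u : Fin (n + 1) | u ≠ r ∧ s u = v}

/-- `|T(u)|`: the number of nodes having a directed path to `u` (including `u` itself). -/
def subtreeSize (s : Fin (n + 1) → Fin (n + 1)) (u : Fin (n + 1)) : ℕ :=
  Nat.card {w : Fin (n + 1) | ∃ k, s^[k] w = u}

/-- Cost of the agent at node `v` with respect to the root `r`:
the sum, over the edges `(u, u')` of the unique directed path from `v` to `r`,
of `indeg(u') / |T(u)|`; the cost is `∞` if no such path exists. -/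
def cost (r : Fin (n + 1)) (s : Fin (n + 1) → Fin (n + 1)) (v : Fin (n + 1)) : ℝ≥0∞ :=
  if h : ∃ k, s^[k] v = r then
    ∑ k ∈ Finset.range (Nat.find h),
      (indeg r s (s^[k + 1] v) : ℝ≥0∞) / (subtreeSize s (s^[k] v) : ℝ≥0∞)
  else ⊤

/-- A valid strategy profile: the root is absorbing (a formal convention encoding that the
root activates no edge), and every agent chooses a node different from herself. -/
def ValidProfile (r : Fin (n + 1)) (s : Fin (n + 1) → Fin (n + 1)) : Prop :=
  s r = r ∧ ∀ v, v ≠ r → s v ≠ v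

/-- Pure Nash equilibrium (the induced network is *stable*): no agent can strictly
decrease her cost by unilaterally switching her activated edge to another node. -/
def IsStable (r : Fin (n + 1)) (s : Fin (n + 1) → Fin (n + 1)) : Prop :=
  ValidProfile r s ∧
    ∀ v, v ≠ r → ∀ w, w ≠ v → cost r s v ≤ cost r (Function.update s v w) v

/-- Social cost: the sum of the costs of all agents (the non-root nodes). -/
def SC (s : Fin (n + 1) → Fin (n + 1)) : ℝ≥0∞ :=
  ∑ v ∈ Finset.univ.erase (0 : Fin (n + 1)), cost 0 s v

/-- Height of the induced network: the maximum length of a (leaf-to-)root path,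
i.e. the least `k` such that every node arrives at the root after `k` steps. -/
def height (s : Fin (n + 1) → Fin (n + 1)) : ℕ :=
  sInf {k | ∀ v, s^[k] v = 0}

/-- Fairness Ratio: maximum agent cost divided by minimum agent cost. -/
def FR (s : Fin (n + 1) → Fin (n + 1)) : ℝ≥0∞ :=
  (⨆ (v : Fin (n + 1)) (_ : v ≠ 0), cost 0 s v) /
    (⨅ (v : Fin (n + 1)) (_ : v ≠ 0), cost 0 s v)

theorem eq_root_of_iterate_succ_eq {r : Fin (n + 1)} {s : Fin (n + 1) → Fin (n + 1)}
    (hr : s r = r) {v : Fin (n + 1)} (hv : ∃ k, s^[k] v = r) {j : ℕ} (hj : s^[j + 1] v = v) :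
    v = r := by
  obtain ⟨k, hk⟩ := hv
  have hper : s^[(j + 1) * k] v = v := by
    rw [iterate_mul]
    exact iterate_fixed hj k
  have hle : (j + 1) * k = j * k + k := by ring
  rw [hle, iterate_add_apply, hk, iterate_fixed hr] at hper
  exact hper.symm

theorem subtreeSize_pos (s : Fin (n + 1) → Fin (n + 1)) (u : Fin (n + 1)) :
    0 < subtreeSize s u := by
  have : Nonempty {w : Fin (n + 1) | ∃ k, s^[k] w = u} := ⟨⟨u, 0, rfl⟩⟩
  exact Nat.card_pos

theorem subtreeSize_lt_subtreeSize_apply {r : Fin (n + 1)} {s : Fin (n + 1) → Fin (n + 1)}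
    (hr : s r = r) {v : Fin (n + 1)} (hv : ∃ k, s^[k] v = r) (hvr : v ≠ r) :
    subtreeSize s v < subtreeSize s (s v) := by
  have hlt : {w : Fin (n + 1) | ∃ k, s^[k] w = v} ⊂ {w : Fin (n + 1) | ∃ k, s^[k] w = s v} := by
    refine ⟨?_, fun h => ?_⟩
    · rintro w ⟨k, hk⟩
      exact ⟨k + 1, by rw [iterate_succ_apply', hk]⟩
    · obtain ⟨k, hk⟩ := h (⟨0, rfl⟩ : s v ∈ {w : Fin (n + 1) | ∃ k, s^[k] w = s v})
      exact hvr (eq_root_of_iterate_succ_eq hr hv (j := k) hk)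
  exact Set.ncard_lt_ncard hlt

theorem indeg_apply_pos {r : Fin (n + 1)} (s : Fin (n + 1) → Fin (n + 1)) {v : Fin (n + 1)}
    (hvr : v ≠ r) : 0 < indeg r s (s v) := by
  have : Nonempty {u : Fin (n + 1) | u ≠ r ∧ s u = s v} := ⟨⟨v, hvr, rfl⟩⟩
  exact Nat.card_pos

theorem cost_root (r : Fin (n + 1)) (s : Fin (n + 1) → Fin (n + 1)) : cost r s r = 0 := by
  have h : ∃ k, s^[k] r = r := ⟨0, rfl⟩
  have h0 : Nat.find h = 0 := (Nat.find_eq_zero h).2 rfl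
  rw [cost, dif_pos h, h0, Finset.range_zero, Finset.sum_empty]

theorem cost_eq_add_cost_apply {r : Fin (n + 1)} {s : Fin (n + 1) → Fin (n + 1)}
    {v : Fin (n + 1)} (hvr : v ≠ r) :
    cost r s v = (indeg r s (s v) : ℝ≥0∞) / (subtreeSize s v : ℝ≥0∞) + cost r s (s v) := by
  by_cases h : ∃ k, s^[k] v = r
  · have h' : ∃ k, s^[k + 1] v = r := by
      obtain ⟨k, hk⟩ := h
      cases k with
      | zero => exact absurd hk hvr
      | succ k => exact ⟨k, hk⟩
    have h'' : ∃ k, s^[k] (s v) = r := h'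
    have hfind : Nat.find h = Nat.find h'' + 1 := Nat.find_comp_succ h h' hvr
    rw [cost, dif_pos h, cost, dif_pos h'', hfind, Finset.sum_range_succ', add_comm]
    rfl
  · have h'' : ¬ ∃ k, s^[k] (s v) = r := fun ⟨k, hk⟩ => h ⟨k + 1, hk⟩
    rw [cost, dif_neg h, cost, dif_neg h'', add_top]

theorem cost_ne_top {r : Fin (n + 1)} {s : Fin (n + 1) → Fin (n + 1)} {v : Fin (n + 1)}
    (hv : ∃ k, s^[k] v = r) : cost r s v ≠ ⊤ := by
  rw [cost, dif_pos hv]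
  exact ENNReal.sum_ne_top.2 fun k _ => ENNReal.div_ne_top (ENNReal.natCast_ne_top _)
    (Nat.cast_ne_zero.2 (subtreeSize_pos s _).ne')

/-- If reaching `x` in `s'` propagates backwards along the edges of `s`, then every node that
reaches `x` in `s` also reaches `x` in `s'`. -/
theorem reaches_of_reaches {s s' : Fin (n + 1) → Fin (n + 1)} {x : Fin (n + 1)}
    (h : ∀ w, (∃ k, s'^[k] (s w) = x) → ∃ k, s'^[k] w = x) {w : Fin (n + 1)}
    (hw : ∃ k, s^[k] w = x) : ∃ k, s'^[k] w = x := by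
  obtain ⟨k, hk⟩ := hw
  induction k generalizing w with
  | zero => exact ⟨0, hk⟩
  | succ k ih => exact h w (ih hk)

theorem subtreeSize_update_self (s : Fin (n + 1) → Fin (n + 1)) (v q : Fin (n + 1)) :
    subtreeSize (update s v q) v = subtreeSize s v := by
  have hset : {w : Fin (n + 1) | ∃ k, (update s v q)^[k] w = v} = {w | ∃ k, s^[k] w = v} := by
    ext w
    constructor <;> refine reaches_of_reaches fun w hw => ?_ <;>
      rcases eq_or_ne w v with rfl | hwv
    · exact ⟨0, rfl⟩
    · rw [update_of_ne hwv] at hw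
      obtain ⟨k, hk⟩ := hw
      exact ⟨k + 1, hk⟩
    · exact ⟨0, rfl⟩
    · obtain ⟨k, hk⟩ := hw
      exact ⟨k + 1, by rwa [iterate_succ_apply, update_of_ne hwv]⟩
  rw [subtreeSize, subtreeSize, hset]

theorem iterate_update_of_not_reaches {s : Fin (n + 1) → Fin (n + 1)} {v q w : Fin (n + 1)}
    (hw : ∀ k, s^[k] w ≠ v) (k : ℕ) : (update s v q)^[k] w = s^[k] w := by
  induction k with
  | zero => rfl
  | succ k ih => rw [iterate_succ_apply', iterate_succ_apply', ih, update_of_ne (hw k)]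

/-- Shortcutting the edge of `v` to a node `q` above it preserves the subtree sizes of all
nodes above `q`. -/
theorem subtreeSize_update_of_reaches {s : Fin (n + 1) → Fin (n + 1)} {v q x : Fin (n + 1)}
    (hvq : ∃ k, s^[k] v = q) (hqv : ∀ k, s^[k] q ≠ v) (hqx : ∃ k, s^[k] q = x) :
    subtreeSize (update s v q) x = subtreeSize s x := by
  obtain ⟨a, ha⟩ := hvq
  obtain ⟨b, hb⟩ := hqx
  have hset : {w : Fin (n + 1) | ∃ k, (update s v q)^[k] w = x} = {w | ∃ k, s^[k] w = x} := by
    ext w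
    constructor <;> refine reaches_of_reaches fun w hw => ?_ <;>
      rcases eq_or_ne w v with rfl | hwv
    · exact ⟨b + a, by rw [iterate_add_apply, ha, hb]⟩
    · rw [update_of_ne hwv] at hw
      obtain ⟨k, hk⟩ := hw
      exact ⟨k + 1, hk⟩
    · exact ⟨b + 1, by
        rw [iterate_succ_apply, update_self, iterate_update_of_not_reaches hqv, hb]⟩
    · obtain ⟨k, hk⟩ := hw
      exact ⟨k + 1, by rwa [iterate_succ_apply, update_of_ne hwv]⟩
  rw [subtreeSize, subtreeSize, hset]

theorem indeg_update_of_ne {r : Fin (n + 1)} {s : Fin (n + 1) → Fin (n + 1)}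
    {v q y : Fin (n + 1)} (hyq : y ≠ q) (hyv : y ≠ s v) :
    indeg r (update s v q) y = indeg r s y := by
  have hset : {u : Fin (n + 1) | u ≠ r ∧ update s v q u = y} = {u | u ≠ r ∧ s u = y} := by
    ext u
    rcases eq_or_ne u v with rfl | huv
    · simp [hyq.symm, hyv.symm]
    · simp [update_of_ne huv]
  rw [indeg, indeg, hset]

theorem indeg_update_self {r : Fin (n + 1)} {s : Fin (n + 1) → Fin (n + 1)}
    {v q : Fin (n + 1)} (hvr : v ≠ r) (hq : s v ≠ q) :
    indeg r (update s v q) q = indeg r s q + 1 := by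
  have hset : {u : Fin (n + 1) | u ≠ r ∧ update s v q u = q} =
      insert v {u | u ≠ r ∧ s u = q} := by
    ext u
    rcases eq_or_ne u v with rfl | huv
    · simp [hvr]
    · simp [huv]
  rw [indeg, indeg, hset]
  exact Set.ncard_insert_of_notMem fun h => hq h.2

/-- Replacing the edge of `v` by an edge to its grandparent does not change the cost of the
nodes above the grandparent. -/
theorem cost_update_grandparent {r : Fin (n + 1)} {s : Fin (n + 1) → Fin (n + 1)}
    (hr : s r = r) (htree : ∀ v, ∃ k, s^[k] v = r) {v : Fin (n + 1)} (hvr : v ≠ r)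
    {x : Fin (n + 1)} (hx : ∃ k, s^[k] (s (s v)) = x) :
    cost r (update s v (s (s v))) x = cost r s x := by
  have hqv : ∀ k, s^[k] (s (s v)) ≠ v := fun k hk =>
    hvr (eq_root_of_iterate_succ_eq hr (htree v) (j := k + 1) hk)
  obtain ⟨m, hm⟩ := htree x
  induction m generalizing x with
  | zero =>
    obtain rfl : x = r := hm
    rw [cost_root, cost_root]
  | succ m ih =>
    by_cases hxr : x = r
    · rw [hxr, cost_root, cost_root]
    obtain ⟨b, hb⟩ := hx
    have hxv : x ≠ v := fun h => hqv b (hb.trans h)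
    have hxq : s x ≠ s (s v) := fun h =>
      hxr (eq_root_of_iterate_succ_eq hr (htree x) (j := b)
        (by rw [iterate_succ_apply, h, hb]))
    have hxp : s x ≠ s v := fun h =>
      hxr (eq_root_of_iterate_succ_eq hr (htree x) (j := b + 1)
        (by rw [iterate_succ_apply, iterate_succ_apply, h, hb]))
    rw [cost_eq_add_cost_apply hxr, cost_eq_add_cost_apply hxr, update_of_ne hxv,
      indeg_update_of_ne hxq hxp, subtreeSize_update_of_reaches (q := s (s v)) ⟨2, rfl⟩ hqv ⟨b, hb⟩,
      ih ⟨b + 1, by rw [iterate_succ_apply', hb]⟩ hm]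

/-- In a stable tree, no agent gains by switching to her grandparent; this bounds the in-degree
of the grandparent from below. -/
theorem IsStable.indeg_apply_apply_ge {r : Fin (n + 1)} {s : Fin (n + 1) → Fin (n + 1)}
    (hs : IsStable r s) (htree : ∀ v, ∃ k, s^[k] v = r) {v : Fin (n + 1)} (hvr : v ≠ r)
    (hpr : s v ≠ r) :
    ((subtreeSize s (s v) : ℝ) / ((subtreeSize s (s v) : ℝ) - (subtreeSize s v : ℝ))) *
      ((indeg r s (s v) : ℝ) - 1) ≤ (indeg r s (s (s v)) : ℝ) := by
  have hr := hs.1.1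
  have hqv : s (s v) ≠ v := fun h =>
    hvr (eq_root_of_iterate_succ_eq hr (htree v) (j := 1) h)
  have hpq : s v ≠ s (s v) := (hs.1.2 _ hpr).symm
  have hlt : (subtreeSize s v : ℝ) < subtreeSize s (s v) :=
    Nat.cast_lt.2 (subtreeSize_lt_subtreeSize_apply hr (htree v) hvr)
  have hpos : (0 : ℝ) < subtreeSize s v := Nat.cast_pos.2 (subtreeSize_pos s v)
  have hT : (subtreeSize s v : ℝ≥0∞) ≠ 0 := Nat.cast_ne_zero.2 (subtreeSize_pos s v).ne'
  have hS : (subtreeSize s (s v) : ℝ≥0∞) ≠ 0 := Nat.cast_ne_zero.2 (subtreeSize_pos s _).ne'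
  have hle := hs.2 v hvr _ hqv
  rw [cost_eq_add_cost_apply hvr, cost_eq_add_cost_apply hpr, cost_eq_add_cost_apply hvr,
    update_self, indeg_update_self hvr hpq, subtreeSize_update_self,
    cost_update_grandparent hr htree hvr (x := s (s v)) ⟨0, rfl⟩, ← add_assoc,
    ENNReal.add_le_add_iff_right (cost_ne_top (htree _))] at hle
  have hdiv {a b : ℕ} (hb : (b : ℝ≥0∞) ≠ 0) : (a : ℝ≥0∞) / b ≠ ⊤ :=
    ENNReal.div_ne_top (ENNReal.natCast_ne_top _) hb
  have hreal := ENNReal.toReal_mono (hdiv hT) hle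
  rw [ENNReal.toReal_add (hdiv hT) (hdiv hS)] at hreal
  simp only [ENNReal.toReal_div, ENNReal.toReal_natCast] at hreal
  push_cast at hreal
  have hpos' := hpos.trans hlt
  rw [div_add_div _ _ hpos.ne' hpos'.ne', div_le_div_iff₀ (mul_pos hpos hpos') hpos] at hreal
  rw [div_mul_eq_mul_div, div_le_iff₀ (sub_pos.2 hlt)]
  refine le_of_mul_le_mul_right ?_ hpos
  nlinarith

/-- In a stable tree, the in-degree does not decrease when moving from a non-leaf agent to her
parent. -/
theorem IsStable.indeg_apply_le {r : Fin (n + 1)} {s : Fin (n + 1) → Fin (n + 1)}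
    (hs : IsStable r s) (htree : ∀ v, ∃ k, s^[k] v = r) {v : Fin (n + 1)} (hvr : v ≠ r)
    (hpr : s v ≠ r) : indeg r s (s v) ≤ indeg r s (s (s v)) := by
  have hlt : (subtreeSize s v : ℝ) < subtreeSize s (s v) :=
    Nat.cast_lt.2 (subtreeSize_lt_subtreeSize_apply hs.1.1 (htree v) hvr)
  have hpos : (0 : ℝ) < subtreeSize s v := Nat.cast_pos.2 (subtreeSize_pos s v)
  have hone : 1 ≤ indeg r s (s v) := indeg_apply_pos s hvr
  rcases hone.eq_or_lt with h1 | h2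
  · exact h1 ▸ indeg_apply_pos s hpr
  have hfac : 1 < (subtreeSize s (s v) : ℝ) /
      ((subtreeSize s (s v) : ℝ) - (subtreeSize s v : ℝ)) := by
    rw [one_lt_div (sub_pos.2 hlt)]
    linarith
  have hd : (0 : ℝ) < (indeg r s (s v) : ℝ) - 1 := sub_pos.2 (Nat.one_lt_cast.2 h2)
  have hreal := (lt_mul_of_one_lt_left hd hfac).trans_le
    (hs.indeg_apply_apply_ge htree hvr hpr)
  have hnat : indeg r s (s v) < indeg r s (s (s v)) + 1 := by
    have : (indeg r s (s v) : ℝ) < indeg r s (s (s v)) + 1 := by linarith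
    exact_mod_cast this
  exact Nat.lt_succ_iff.1 hnat

/-- Along any leaf-to-root path `P = (z = u_k, …, u_0 = r)` of length `k`
in a stable tree, for every `1 < i < k` one has
`d_{i-1} ≥ (|T_i| / (|T_i| − |T_{i+1}|)) · (d_i − 1)`, and in particular the in-degree
sequence is monotonically non-decreasing towards the root: `d_i ≥ d_{i+1}`.
Here `u_j = s^[k−j] z`, `d_j = indeg(u_j)` and `T_j = T(u_j)`. -/
theorem degree_formula_along_path {n : ℕ} (s : Fin (n + 1) → Fin (n + 1))
    (hstable : IsStable 0 s) (htree : ∀ v, ∃ k, s^[k] v = 0)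
    (z : Fin (n + 1)) (k : ℕ)
    (hleaf : indeg 0 s z = 0)
    (hpath : s^[k] z = 0) (hminimal : ∀ j < k, s^[j] z ≠ 0) :
    ∀ i, 1 < i → i < k →
      ((subtreeSize s (s^[k - i] z) : ℝ) /
          ((subtreeSize s (s^[k - i] z) : ℝ) - (subtreeSize s (s^[k - (i + 1)] z) : ℝ))) *
          ((indeg 0 s (s^[k - i] z) : ℝ) - 1) ≤ (indeg 0 s (s^[k - (i - 1)] z) : ℝ) ∧
      indeg 0 s (s^[k - (i + 1)] z) ≤ indeg 0 s (s^[k - i] z) := by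
  intro i hi hik
  have hstep : ∀ a b, a + 1 = b → s^[b] z = s (s^[a] z) := by
    rintro a _ rfl
    exact iterate_succ_apply' s a z
  have e₁ := hstep (k - (i + 1)) (k - i) (by omega)
  have e₀ := hstep (k - i) (k - (i - 1)) (by omega)
  have h₂ := hminimal (k - (i + 1)) (by omega)
  have h₁ := hminimal (k - i) (by omega)
  rw [e₁] at h₁
  refine ⟨?_, ?_⟩
  · rw [e₀, e₁]
    exact hstable.indeg_apply_apply_ge htree h₂ h₁
  · rcases (show i + 1 ≤ k from hik).eq_or_lt with rfl | hlt
    · simp [hleaf]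
    · have e₂ := hstep (k - (i + 2)) (k - (i + 1)) (by omega)
      have h₃ := hminimal (k - (i + 2)) (by omega)
      rw [e₂] at h₂
      rw [e₁, e₂]
      exact hstable.indeg_apply_le htree h₃ h₂

end TCG
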